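/- arXiv:1402.1570 — 4 statements merged into one kernel-verified Lean document; each statement's English description precedes it below -/
import Mathlib

section
/- Let l be a natural number and let P be a set of l points on the unit circle in the Euclidean plane ℝ². Let 𝓘 be a finite set of unordered pairs {x, y} with x, y ∈ P (the case x = y is allowed, giving a degenerate chord consisting of a single point), such that for any two members {x, y} and {x', y'} of 𝓘 the closed segments [x, y] and [x', y'] have a common point. Then the cardinality of 𝓘 is at most l. -/
/-- The (possibly degenerate) chord determined by an unordered pair of points
in the plane: the closed segment joining them. -/
def chordSeg : Sym2 (ℝ × ℝ) → Set (ℝ × ℝ) :=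
  Sym2.lift ⟨fun x y => segment ℝ x y, fun x y => segment_symm ℝ x y⟩

/-- A set of unordered pairs from a finite subset `S` of a linear order, such that no pair lies
entirely below another and no pair is strictly nested in another, has at most `S.card` members. -/
theorem Sym2.card_le_card_of_inf_le_sup_of_not_nested {α : Type*} [LinearOrder α] (S : Finset α)
    (I : Finset (Sym2 α)) (hS : ∀ z ∈ I, ∀ x ∈ z, x ∈ S)
    (hle : ∀ z ∈ I, ∀ z' ∈ I, z.inf ≤ z'.sup)
    (hnest : ∀ z ∈ I, ∀ z' ∈ I, z.inf < z'.inf → z.sup ≤ z'.sup) :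
    I.card ≤ S.card := by
  obtain rfl | hI := I.eq_empty_or_nonempty
  · simp
  let rank : α → ℕ := fun x => (S.filter (· < x)).card
  have rank_mono : Monotone rank := fun x y hxy =>
    Finset.card_le_card fun w hw => by
      simp only [Finset.mem_filter] at hw ⊢
      exact ⟨hw.1, hw.2.trans_le hxy⟩
  have rank_lt : ∀ x ∈ S, ∀ y, x < y → rank x < rank y := fun x hx y hxy =>
    Finset.card_lt_card <| (Finset.ssubset_iff_of_subset fun w hw => by
      simp only [Finset.mem_filter] at hw ⊢
      exact ⟨hw.1, hw.2.trans hxy⟩).2 ⟨x, by simp [hx, hxy], by simp⟩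
  have rank_lt_card : ∀ x ∈ S, rank x < S.card := fun x hx =>
    Finset.card_lt_card <| (Finset.ssubset_iff_of_subset (Finset.filter_subset _ _)).2
      ⟨x, hx, by simp⟩
  have inf_mem : ∀ z ∈ I, z.inf ∈ S := fun z hz => hS z hz _ <| by
    induction z with | _ x y => rcases le_total x y with h | h <;> simp [h]
  have sup_mem : ∀ z ∈ I, z.sup ∈ S := fun z hz => hS z hz _ <| by
    induction z with | _ x y => rcases le_total x y with h | h <;> simp [h]
  obtain ⟨m, hm, hmax⟩ := I.exists_max_image Sym2.inf hI
  rw [← Nat.add_sub_cancel_left (n := rank m.inf) (m := S.card), ← Nat.card_Ico]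
  refine Finset.card_le_card_of_injOn (fun z => rank z.inf + rank z.sup) ?_ ?_
  · intro z hz
    have h₁ := rank_mono (hmax z hz)
    have h₂ := rank_mono (hle m hm z hz)
    have h₃ := rank_lt_card _ (sup_mem z hz)
    simp only [Finset.coe_Ico, Set.mem_Ico]
    omega
  · have sum_lt : ∀ z ∈ I, ∀ z' ∈ I, z.inf < z'.inf →
        rank z.inf + rank z.sup < rank z'.inf + rank z'.sup := fun z hz z' hz' h =>
      add_lt_add_of_lt_of_le (rank_lt _ (inf_mem z hz) _ h) (rank_mono (hnest z hz z' hz' h))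
    intro z hz z' hz' h
    simp only at h
    have hinf : z.inf = z'.inf := le_antisymm
      (not_lt.1 fun hlt => (sum_lt z' hz' z hz hlt).ne' h)
      (not_lt.1 fun hlt => (sum_lt z hz z' hz' hlt).ne h)
    rw [hinf, Nat.add_left_cancel_iff] at h
    have hsup : z.sup = z'.sup := le_antisymm
      (not_lt.1 fun hlt => (rank_lt _ (sup_mem z' hz') _ hlt).ne' h)
      (not_lt.1 fun hlt => (rank_lt _ (sup_mem z hz) _ hlt).ne h)
    exact Sym2.inf_eq_inf_and_sup_eq_sup.1 ⟨hinf, hsup⟩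

/-- A point of the circle beyond the arc `[a, b]` lies strictly on the other side of the chord
joining the endpoints of that arc. -/
theorem Real.cos_sub_midpoint_lt {a b t : ℝ} (hab : a ≤ b) (hbt : b < t)
    (hta : t < a + 2 * Real.pi) :
    Real.cos (t - (a + b) / 2) < Real.cos ((b - a) / 2) := by
  have h := Real.cos_sub_cos (t - (a + b) / 2) ((b - a) / 2)
  have h₁ : 0 < Real.sin ((t - (a + b) / 2 + (b - a) / 2) / 2) :=
    Real.sin_pos_of_pos_of_lt_pi (by linarith) (by linarith)
  have h₂ : 0 < Real.sin ((t - (a + b) / 2 - (b - a) / 2) / 2) :=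
    Real.sin_pos_of_pos_of_lt_pi (by linarith) (by linarith)
  nlinarith [mul_pos h₁ h₂]

/-- The chord of an arc is disjoint from every chord between points beyond that arc. -/
theorem disjoint_segment_of_cos_sin {a b s t : ℝ}
    (hs : Real.cos (s - (a + b) / 2) < Real.cos ((b - a) / 2))
    (ht : Real.cos (t - (a + b) / 2) < Real.cos ((b - a) / 2)) :
    Disjoint (segment ℝ (Real.cos a, Real.sin a) (Real.cos b, Real.sin b))
      (segment ℝ (Real.cos s, Real.sin s) (Real.cos t, Real.sin t)) := by
  rw [Set.disjoint_left]
  rintro _ ⟨u, v, -, -, huv, rfl⟩ ⟨u', v', hu', hv', huv', h⟩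
  have ha : Real.cos (a - (a + b) / 2) = Real.cos ((b - a) / 2) := by
    rw [← Real.cos_neg]; congr 1; ring
  have hb : Real.cos (b - (a + b) / 2) = Real.cos ((b - a) / 2) := by
    congr 1; ring
  rw [Real.cos_sub] at ha hb hs ht
  have h₁ := congrArg Prod.fst h
  have h₂ := congrArg Prod.snd h
  simp only [Prod.fst_add, Prod.snd_add, Prod.smul_fst, Prod.smul_snd, smul_eq_mul] at h₁ h₂
  set k := Real.cos ((b - a) / 2)
  set c := Real.cos ((a + b) / 2)
  set d := Real.sin ((a + b) / 2)
  have hk : u' * (Real.cos s * c + Real.sin s * d) + v' * (Real.cos t * c + Real.sin t * d) = k := by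
    linear_combination c * h₁ + d * h₂ + u * ha + v * hb + k * huv
  have hst : u' * (Real.cos s * c + Real.sin s * d) + v' * (Real.cos t * c + Real.sin t * d) < k :=
    convex_Iio k hs ht hu' hv' huv'
  exact hst.ne hk

/-- The angle of a point in the plane. -/
noncomputable def angleOf (p : ℝ × ℝ) : ℝ := Complex.arg ⟨p.1, p.2⟩

theorem cos_sin_angleOf {p : ℝ × ℝ} (hp : p.1 ^ 2 + p.2 ^ 2 = 1) :
    (Real.cos (angleOf p), Real.sin (angleOf p)) = p := by
  have hnorm : ‖(⟨p.1, p.2⟩ : ℂ)‖ = 1 := by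
    rw [Complex.norm_def, Complex.normSq_mk, ← sq, ← sq, hp, Real.sqrt_one]
  have hne : (⟨p.1, p.2⟩ : ℂ) ≠ 0 := norm_ne_zero_iff.1 (by simp [hnorm])
  ext
  · simp [angleOf, Complex.cos_arg hne, hnorm]
  · simp [angleOf, Complex.sin_arg, hnorm]

theorem chordSeg_eq_segment_angleOf {z : Sym2 (ℝ × ℝ)} (hz : ∀ p ∈ z, p.1 ^ 2 + p.2 ^ 2 = 1) :
    chordSeg z = segment ℝ (Real.cos (z.map angleOf).inf, Real.sin (z.map angleOf).inf)
      (Real.cos (z.map angleOf).sup, Real.sin (z.map angleOf).sup) := by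
  induction z with | _ x y =>
  have hx := cos_sin_angleOf (hz x (Sym2.mem_mk_left x y))
  have hy := cos_sin_angleOf (hz y (Sym2.mem_mk_right x y))
  rw [Sym2.map_mk, Sym2.inf_mk, Sym2.sup_mk]
  rcases le_total (angleOf x) (angleOf y) with h | h
  · rw [inf_eq_left.2 h, sup_eq_right.2 h, hx, hy]
    rfl
  · rw [inf_eq_right.2 h, sup_eq_left.2 h, hx, hy, segment_symm]
    rfl

/-- A family of pairwise intersecting (possibly degenerate) chords between
`l` points on the unit circle has at most `l` members. -/
theorem arcs_stmt0 (l : ℕ) (P : Finset (ℝ × ℝ)) (hPcard : P.card = l)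
    (hPcircle : ∀ p ∈ P, p.1 ^ 2 + p.2 ^ 2 = 1)
    (I : Finset (Sym2 (ℝ × ℝ)))
    (hIP : ∀ z ∈ I, ∀ x ∈ z, x ∈ P)
    (hint : ∀ z ∈ I, ∀ z' ∈ I, (chordSeg z ∩ chordSeg z').Nonempty) :
    I.card ≤ l := by
  classical
  have hcircle : ∀ z ∈ I, ∀ p ∈ z, p.1 ^ 2 + p.2 ^ 2 = 1 :=
    fun z hz p hp => hPcircle p (hIP z hz p hp)
  have hinj : Set.InjOn (Sym2.map angleOf) (I : Set (Sym2 (ℝ × ℝ))) :=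
    Set.LeftInvOn.injOn (f₁' := Sym2.map fun t => (Real.cos t, Real.sin t)) fun z hz => by
      rw [Sym2.map_map]
      exact (Sym2.map_congr fun p hp => cos_sin_angleOf (hcircle z hz p hp)).trans
        (congrFun Sym2.map_id z)
  have hbounds : ∀ z : Sym2 (ℝ × ℝ), -Real.pi < (z.map angleOf).inf ∧
      (z.map angleOf).inf ≤ (z.map angleOf).sup ∧ (z.map angleOf).sup ≤ Real.pi := by
    refine fun z => ⟨?_, Sym2.inf_le_sup _, ?_⟩ <;> induction z with | _ x y => ?_
    · simp [angleOf, Complex.neg_pi_lt_arg]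
    · simp [angleOf, Complex.arg_le_pi]
  rw [← hPcard, ← Finset.card_image_of_injOn hinj]
  refine (Sym2.card_le_card_of_inf_le_sup_of_not_nested (P.image angleOf) _ ?_ ?_ ?_).trans
    Finset.card_image_le
  · simp only [Finset.forall_mem_image, Sym2.mem_map]
    rintro z hz _ ⟨p, hp, rfl⟩
    exact Finset.mem_image_of_mem _ (hIP z hz p hp)
  · simp only [Finset.forall_mem_image]
    intro z hz z' hz'
    by_contra! hlt
    obtain ⟨h₁, h₂, h₃⟩ := hbounds z
    obtain ⟨h₁', h₂', h₃'⟩ := hbounds z'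
    refine Set.not_disjoint_iff_nonempty_inter.2 (hint z' hz' z hz) ?_
    rw [chordSeg_eq_segment_angleOf (hcircle z hz), chordSeg_eq_segment_angleOf (hcircle z' hz')]
    exact disjoint_segment_of_cos_sin
      (Real.cos_sub_midpoint_lt h₂' hlt (by linarith))
      (Real.cos_sub_midpoint_lt h₂' (by linarith) (by linarith))
  · simp only [Finset.forall_mem_image]
    intro z hz z' hz' hinf
    by_contra! hsup
    obtain ⟨h₁, h₂, h₃⟩ := hbounds z
    obtain ⟨h₁', h₂', h₃'⟩ := hbounds z'
    refine Set.not_disjoint_iff_nonempty_inter.2 (hint z' hz' z hz) ?_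
    rw [chordSeg_eq_segment_angleOf (hcircle z hz), chordSeg_eq_segment_angleOf (hcircle z' hz')]
    refine disjoint_segment_of_cos_sin ?_
      (Real.cos_sub_midpoint_lt h₂' hsup (by linarith))
    rw [← Real.cos_add_two_pi, sub_add_eq_add_sub]
    exact Real.cos_sub_midpoint_lt h₂' (by linarith) (by linarith)
end

section
/- Let l ≥ 1 be a natural number. Let C be a finite set of pairs (a, b) of natural numbers with a ≤ b ≤ l − 1, such that for any two distinct pairs (a, b) and (a', b') in C one has: (i) the closed integer intervals [a, b] and [a', b'] have a common element, i.e. max a a' ≤ min b b'; and (ii) neither interval is strictly nested in the other, i.e. it is not the case that a < a' and b' < b, and it is not the case that a' < a and b < b'. Then the cardinality of C is at most l. -/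
/-- A family of pairwise intersecting, pairwise non-strictly-nested integer
intervals with endpoints in `{0, …, l-1}` has at most `l` members. -/
theorem arcs_stmt1 (l : ℕ) (hl : 1 ≤ l) (C : Finset (ℕ × ℕ))
    (hC : ∀ p ∈ C, p.1 ≤ p.2 ∧ p.2 ≤ l - 1)
    (hcross : ∀ p ∈ C, ∀ q ∈ C, p ≠ q →
      max p.1 q.1 ≤ min p.2 q.2 ∧
      ¬(p.1 < q.1 ∧ q.2 < p.2) ∧ ¬(q.1 < p.1 ∧ p.2 < q.2)) :
    C.card ≤ l := by
  have sup_fst_le : ∀ p ∈ C, C.sup Prod.fst ≤ p.2 := by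
    intro p hp
    refine Finset.sup_le fun q hq => ?_
    by_cases hpq : p = q
    · exact hpq ▸ (hC p hp).1
    · have := (hcross p hp q hq hpq).1
      omega
  have maps_to : ∀ p ∈ C,
      p.1 + p.2 ∈ Finset.Ico (C.sup Prod.fst) (C.sup Prod.fst + l) := by
    intro p hp
    have h₁ := sup_fst_le p hp
    have h₂ : p.1 ≤ C.sup Prod.fst := Finset.le_sup (f := Prod.fst) hp
    have h₃ := (hC p hp).2
    rw [Finset.mem_Ico]
    omega
  have inj_on : Set.InjOn (fun p : ℕ × ℕ => p.1 + p.2) C := by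
    intro p hp q hq hsum
    by_contra hpq
    obtain ⟨-, h₁, h₂⟩ := hcross p hp q hq hpq
    have hsum' : p.1 + p.2 = q.1 + q.2 := hsum
    exact hpq (Prod.ext (by omega) (by omega))
  simpa using Finset.card_le_card_of_injOn _ maps_to inj_on
end

section
/- Let l ≥ 1 be a natural number. Let C be a finite set of pairs (a, b) of natural numbers with a ≤ b ≤ l − 1, such that for any two pairs (a, b) and (a', b') in C the closed integer intervals [a, b] and [a', b'] have a common element (max a a' ≤ min b b'), and such that the map sending (a, b) to the sum a + b is injective on C. Then the cardinality of C is at most l. -/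
/-- A family of pairwise intersecting integer intervals with endpoints in
`{0, …, l-1}` and pairwise distinct centres has at most `l` members. -/
theorem arcs_stmt2 (l : ℕ) (hl : 1 ≤ l) (C : Finset (ℕ × ℕ))
    (hC : ∀ p ∈ C, p.1 ≤ p.2 ∧ p.2 ≤ l - 1)
    (hint : ∀ p ∈ C, ∀ q ∈ C, max p.1 q.1 ≤ min p.2 q.2)
    (hinj : ∀ p ∈ C, ∀ q ∈ C, p.1 + p.2 = q.1 + q.2 → p = q) :
    C.card ≤ l := by
  -- The largest left endpoint `i` lies in every interval.
  set i := C.sup Prod.fst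
  have left_le : ∀ p ∈ C, p.1 ≤ i := fun p hp => Finset.le_sup (f := Prod.fst) hp
  have le_right : ∀ p ∈ C, i ≤ p.2 := fun p hp => Finset.sup_le fun q hq =>
    (le_max_right _ _).trans ((hint p hp q hq).trans (min_le_left _ _))
  have hmaps : Set.MapsTo (fun p : ℕ × ℕ => p.1 + p.2) C (Finset.Ico i (i + l)) := by
    intro p hp
    have := left_le p hp
    have := le_right p hp
    have := (hC p hp).2
    simp only [Finset.coe_Ico, Set.mem_Ico]
    lia
  simpa using Finset.card_le_card_of_injOn _ hmaps fun p hp q hq h => hinj p hp q hq h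
end

section
/- Let S be a finite set of vectors in ℤ × ℤ such that every (a, b) ∈ S is primitive (gcd a b = 1), any two distinct elements (a, b), (c, d) of S are not proportional (a·d − b·c ≠ 0), and any two elements (a, b), (c, d) of S satisfy |a·d − b·c| ≤ 1. Then S has cardinality at most 3. -/
/-- The Plücker relation among the six `2 × 2` minors of four plane vectors cannot hold
when all the minors are odd. -/
theorem not_forall_odd_det (p q r s : ℤ × ℤ)
    (hpq : Odd (p.1 * q.2 - p.2 * q.1)) (hpr : Odd (p.1 * r.2 - p.2 * r.1))
    (hps : Odd (p.1 * s.2 - p.2 * s.1)) (hqr : Odd (q.1 * r.2 - q.2 * r.1))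
    (hqs : Odd (q.1 * s.2 - q.2 * s.1)) (hrs : Odd (r.1 * s.2 - r.2 * s.1)) : False := by
  have hodd := ((hpq.mul hrs).sub_odd (hpr.mul hqs)).add_odd (hps.mul hqr)
  have hzero : (p.1 * q.2 - p.2 * q.1) * (r.1 * s.2 - r.2 * s.1)
      - (p.1 * r.2 - p.2 * r.1) * (q.1 * s.2 - q.2 * s.1)
      + (p.1 * s.2 - p.2 * s.1) * (q.1 * r.2 - q.2 * r.1) = 0 := by ring
  rw [hzero] at hodd
  exact absurd hodd (by decide)

/-- A set of pairwise non-proportional primitive integer vectors with pairwise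
determinants of absolute value at most 1 has at most 3 elements. -/
theorem arcs_stmt6 (S : Finset (ℤ × ℤ))
    (hprim : ∀ p ∈ S, Int.gcd p.1 p.2 = 1)
    (hprop : ∀ p ∈ S, ∀ q ∈ S, p ≠ q → p.1 * q.2 - p.2 * q.1 ≠ 0)
    (hdet : ∀ p ∈ S, ∀ q ∈ S, |p.1 * q.2 - p.2 * q.1| ≤ 1) :
    S.card ≤ 3 := by
  have hodd : ∀ p ∈ S, ∀ q ∈ S, p ≠ q → Odd (p.1 * q.2 - p.2 * q.1) := by
    intro p hp q hq hne
    have h0 := hprop p hp q hq hne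
    have h1 := abs_le.mp (hdet p hp q hq)
    rw [Int.odd_iff]
    omega
  by_contra! hcard
  obtain ⟨T, hTS, hT⟩ := Finset.exists_subset_card_eq (Nat.succ_le_of_lt hcard)
  obtain ⟨p, U, hpU, rfl, hU⟩ := Finset.card_eq_succ.mp hT
  obtain ⟨q, r, s, hqr, hqs, hrs, rfl⟩ := Finset.card_eq_three.mp hU
  simp only [Finset.insert_subset_iff, Finset.singleton_subset_iff] at hTS
  obtain ⟨hp, hq, hr, hs⟩ := hTS
  simp only [Finset.mem_insert, Finset.mem_singleton, not_or] at hpU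
  obtain ⟨hpq, hpr, hps⟩ := hpU
  exact not_forall_odd_det p q r s (hodd p hp q hq hpq) (hodd p hp r hr hpr)
    (hodd p hp s hs hps) (hodd q hq r hr hqr) (hodd q hq s hs hqs) (hodd r hr s hs hrs)
end
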